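/- Let 1/2 < γ ≤ 1, 2 < m < 3, 1 < α ≤ 2, 0 < ε < 1, and h ∈ [ε,1]. If (2γ−1)α² ≥ γ²(α² − γ²(m−1)/4) and l₂(α,h) ≥ 0, then l₁(α,h) ≥ 0. -/

import Mathlib

/-- `f(h) = h^m - ε^m` (real powers). -/
noncomputable def f (m ε h : ℝ) : ℝ := h ^ m - ε ^ m

/-- `f'(h) = m h^{m-1}`. -/
noncomputable def f' (m h : ℝ) : ℝ := m * h ^ (m - 1)

/-- `f''(h) = m (m-1) h^{m-2}`. -/
noncomputable def f'' (m h : ℝ) : ℝ := m * (m - 1) * h ^ (m - 2)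

/-- `l₁(α,h) = α⁴ f³ − α² h f² f' + 2α²(1−h²) f f'² − 2h(1−h²) f'³ + (1−h²)² f'² f''`. -/
noncomputable def l₁ (m ε α h : ℝ) : ℝ :=
  α ^ 4 * f m ε h ^ 3 - α ^ 2 * h * f m ε h ^ 2 * f' m h
    + 2 * α ^ 2 * (1 - h ^ 2) * f m ε h * f' m h ^ 2
    - 2 * h * (1 - h ^ 2) * f' m h ^ 3 + (1 - h ^ 2) ^ 2 * f' m h ^ 2 * f'' m h

/-- `l₂(α,h) = (α² − γ²(m−1)/4) f − h f' + ((1−h²)/2) f''`. -/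
noncomputable def l₂ (γ m ε α h : ℝ) : ℝ :=
  (α ^ 2 - γ ^ 2 * (m - 1) / 4) * f m ε h - h * f' m h + ((1 - h ^ 2) / 2) * f'' m h

/-- if `1/2 < γ ≤ 1`, `2 < m < 3`, `1 < α ≤ 2`, `0 < ε < 1`, `h ∈ [ε,1]`,
`(2γ−1)α² ≥ γ²(α² − γ²(m−1)/4)` and `l₂(α,h) ≥ 0`, then `l₁(α,h) ≥ 0`. -/
theorem stmt_8 (γ m α ε h : ℝ) (hγ₁ : 1 / 2 < γ) (hγ₂ : γ ≤ 1)
    (hm₁ : 2 < m) (hm₂ : m < 3) (hα₁ : 1 < α) (hα₂ : α ≤ 2)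
    (hε₁ : 0 < ε) (hε₂ : ε < 1) (hh : h ∈ Set.Icc ε 1)
    (h1 : (2 * γ - 1) * α ^ 2 ≥ γ ^ 2 * (α ^ 2 - γ ^ 2 * (m - 1) / 4))
    (h2 : l₂ γ m ε α h ≥ 0) :
    l₁ m ε α h ≥ 0 := by
  obtain ⟨hh1, hh2⟩ := hh
  have hh0 : 0 < h := lt_of_lt_of_le hε₁ hh1
  have hF : 0 ≤ f m ε h := by
    unfold f
    have := Real.rpow_le_rpow hε₁.le hh1 (by linarith : (0:ℝ) ≤ m)
    linarith
  have hP : 0 < f' m h := by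
    unfold f'
    have := Real.rpow_pos_of_pos hh0 (m - 1)
    have : 0 < m := by linarith
    positivity
  have hQ : h * f'' m h = (m - 1) * f' m h := by
    unfold f' f''
    have : h ^ (m - 1) = h ^ (m - 2) * h := by
      rw [← Real.rpow_add_one hh0.ne']
      congr 1
      ring
    rw [this]
    ring
  have hw : 0 ≤ 1 - h ^ 2 := by nlinarith
  unfold l₂ at h2
  unfold l₁
  generalize f m ε h = F at *
  generalize f' m h = P at *
  generalize f'' m h = Q at *
  have e1 : 0 ≤ (1 - h ^ 2) * P ^ 2 *
      ((α ^ 2 - γ ^ 2 * (m - 1) / 4) * F - h * P + ((1 - h ^ 2) / 2) * Q) :=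
    mul_nonneg (by positivity) h2
  have e2 : 0 ≤ F * (γ ^ 2 * h * P) *
      ((α ^ 2 - γ ^ 2 * (m - 1) / 4) * F - h * P + ((1 - h ^ 2) / 2) * Q) :=
    mul_nonneg (by positivity) h2
  have e3 : 0 ≤ F * (h * F * P) *
      ((2 * γ - 1) * α ^ 2 - γ ^ 2 * (α ^ 2 - γ ^ 2 * (m - 1) / 4)) :=
    mul_nonneg (by positivity) (by linarith)
  have e4 : 0 ≤ F * (α ^ 2 * F - γ * h * P) ^ 2 := by positivity
  linear_combination 2 * e1 + e2 + e3 + e4 + (F * γ ^ 2 * P * (1 - h ^ 2) / 2) * hQ
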